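/- Let A : Matrix (Fin 5) (Fin 2) ℂ and, labelling the rows 1,…,5, set c₁ = P A 1 3 * P A 2 4, c₁' = P A 1 4 * P A 2 3, c₂ = P A 1 3 * P A 2 5, c₂' = P A 1 5 * P A 2 3, c₃ = P A 1 4 * P A 2 5, c₃' = P A 1 5 * P A 2 4, c₄ = P A 1 4 * P A 3 5, c₄' = P A 1 5 * P A 3 4, c₅ = P A 2 4 * P A 3 5, c₅' = P A 2 5 * P A 3 4. Then the following four identities hold: c₁c₂'c₃ = c₁'c₂c₃', c₂'c₄(c₁ − c₁') = c₁'c₄'(c₂ − c₂'), (c₁ − c₁')c₂c₅ = c₁(c₂ − c₂')c₅', and c₃c₄'c₅ = c₃'c₄c₅'. (The image of the cross-ratio embedding of the space of parameters F of the main stratum of G_{5,2} into (ℂP¹)⁵ lies on the intersection of these four hypersurfaces, which defines the algebraic manifold 𝒢 realizing the universal space of parameters.) -/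

import Mathlib

/-- The `2 × 2` minor (Plücker coordinate) `P^{ij}` of a `5 × 2` complex matrix on rows `i, j`. -/
def P (A : Matrix (Fin 5) (Fin 2) ℂ) (i j : Fin 5) : ℂ :=
  A i 0 * A j 1 - A i 1 * A j 0

/-- The cross-ratios `(cᵢ : cᵢ')`, `i = 1,…,5`, of the five points of `ℂP¹` given by the rows of
a `5 × 2` matrix (formed from the ordered 4-tuples `1234, 1235, 1245, 1345, 2345`) satisfy the
four identities cutting out the algebraic manifold `𝒢 ⊆ (ℂP¹)⁵` which realizes the universal
space of parameters of `G_{5,2}`.  (Rows are indexed `0,…,4` instead of `1,…,5`.) -/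
theorem cross_ratios_satisfy_G_equations (A : Matrix (Fin 5) (Fin 2) ℂ)
    (c₁ c₁' c₂ c₂' c₃ c₃' c₄ c₄' c₅ c₅' : ℂ)
    (hc₁ : c₁ = P A 0 2 * P A 1 3) (hc₁' : c₁' = P A 0 3 * P A 1 2)
    (hc₂ : c₂ = P A 0 2 * P A 1 4) (hc₂' : c₂' = P A 0 4 * P A 1 2)
    (hc₃ : c₃ = P A 0 3 * P A 1 4) (hc₃' : c₃' = P A 0 4 * P A 1 3)
    (hc₄ : c₄ = P A 0 3 * P A 2 4) (hc₄' : c₄' = P A 0 4 * P A 2 3)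
    (hc₅ : c₅ = P A 1 3 * P A 2 4) (hc₅' : c₅' = P A 1 4 * P A 2 3) :
    c₁ * c₂' * c₃ = c₁' * c₂ * c₃' ∧
    c₂' * c₄ * (c₁ - c₁') = c₁' * c₄' * (c₂ - c₂') ∧
    (c₁ - c₁') * c₂ * c₅ = c₁ * (c₂ - c₂') * c₅' ∧
    c₃ * c₄' * c₅ = c₃' * c₄ * c₅' := by
  have h1 : c₁ - c₁' = P A 0 1 * P A 2 3 := by
    subst hc₁ hc₁'
    simp only [P]
    ring
  have h2 : c₂ - c₂' = P A 0 1 * P A 2 4 := by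
    subst hc₂ hc₂'
    simp only [P]
    ring
  rw [h1, h2]
  subst hc₁ hc₁' hc₂ hc₂' hc₃ hc₃' hc₄ hc₄' hc₅ hc₅'
  refine ⟨?_, ?_, ?_, ?_⟩ <;> ring
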